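/- Let n ≥ 2 and l, k ≥ 1. In the U_q'(C_n^(1)) crystal B_l ⊗ B_k, the element (l,0,…,0) ⊗ (k,0,…,0) is the unique element u with ẽ_0^{l+k}(u) ≠ 0; that is, for u ∈ B_l ⊗ B_k one has ẽ_0^{l+k}(u) ≠ 0 if and only if u = (l,0,…,0) ⊗ (k,0,…,0). -/

import Mathlib

namespace KTT

/-- Raw data of a crystal element `(x_1,…,x_n,x̄_n,…,x̄_1)`:
`b.1 i` is `x_{i+1}` and `b.2 i` is `x̄_{i+1}` for `i : Fin n`. -/
abbrev Tup (n : ℕ) := (Fin n → ℕ) × (Fin n → ℕ)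

/-- The entry `x_j` (for `1 ≤ j ≤ n`). -/
def xc {n : ℕ} (b : Tup n) (j : ℕ) : ℕ :=
  if h : j - 1 < n then b.1 ⟨j - 1, h⟩ else 0

/-- The entry `x̄_j` (for `1 ≤ j ≤ n`). -/
def xbc {n : ℕ} (b : Tup n) (j : ℕ) : ℕ :=
  if h : j - 1 < n then b.2 ⟨j - 1, h⟩ else 0

/-- Set the entry indexed by `j` (i.e. `x_j`) to the value `v`. -/
def setx {n : ℕ} (f : Fin n → ℕ) (j v : ℕ) : Fin n → ℕ :=
  fun t => if (t : ℕ) + 1 = j then v else f t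

/-- `Σ_{i=1}^n (x_i + x̄_i)`. -/
def tsum {n : ℕ} (b : Tup n) : ℕ := ∑ i, (b.1 i + b.2 i)

/-- The element `(v,0,…,0)`. -/
def uvec (n v : ℕ) : Tup n := (fun j => if (j : ℕ) = 0 then v else 0, fun _ => 0)

/-- The element `(0,v,---,0)` (only `x_2 = v` nonzero). -/
def u2vec (n v : ℕ) : Tup n := (fun j => if (j : ℕ) = 1 then v else 0, fun _ => 0)

/-- The element `(0,0,---,v)` (only `x̄_1 = v` nonzero). -/
def barvec (n v : ℕ) : Tup n := (fun _ => 0, fun j => if (j : ℕ) = 0 then v else 0)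

/-- The element `(a,c,---,d)` with `x_1 = a`, `x_2 = c`, `x̄_1 = d`, all else `0`. -/
def tripleVec (n a c d : ℕ) : Tup n :=
  (fun j => if (j : ℕ) = 0 then a else if (j : ℕ) = 1 then c else 0,
   fun j => if (j : ℕ) = 0 then d else 0)

/-! ### The `U_q'(C_n^{(1)})` crystal `B_l` -/

/-- Membership in the `C_n^{(1)}` crystal `B_l` : the sum of the entries belongs to
`{l, l-2, l-4, …}`. -/
def memC (n l : ℕ) (b : Tup n) : Prop := tsum b ≤ l ∧ (l - tsum b) % 2 = 0

def BC (n l : ℕ) : Set (Tup n) := {b | memC n l b}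

/-- The number `x_0(b)` of `(0,0̄)` pairs. -/
def x0 (l : ℕ) {n : ℕ} (b : Tup n) : ℕ := (l - tsum b) / 2

/-- The operator `ẽ_i` on `B_l` (C case); `none` plays the role of `0`. -/
def eC (n l i : ℕ) (b : Tup n) : Option (Tup n) :=
  if i = 0 then
    if 0 < n then
      if xbc b 1 + 2 ≤ xc b 1 then some (setx b.1 1 (xc b 1 - 2), b.2)
      else if xc b 1 = xbc b 1 + 1 then
        some (setx b.1 1 (xc b 1 - 1), setx b.2 1 (xbc b 1 + 1))
      else if tsum b + 2 ≤ l then some (b.1, setx b.2 1 (xbc b 1 + 2))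
      else none
    else none
  else if i = n then
    if 0 < xbc b n then some (setx b.1 n (xc b n + 1), setx b.2 n (xbc b n - 1))
    else none
  else if i < n then
    if xbc b (i + 1) < xc b (i + 1) then
      some (setx (setx b.1 i (xc b i + 1)) (i + 1) (xc b (i + 1) - 1), b.2)
    else if 0 < xbc b i then
      some (b.1, setx (setx b.2 (i + 1) (xbc b (i + 1) + 1)) i (xbc b i - 1))
    else none
  else none

/-- The operator `f̃_i` on `B_l` (C case). -/
def fC (n l i : ℕ) (b : Tup n) : Option (Tup n) :=
  if i = 0 then
    if 0 < n then
      if xbc b 1 ≤ xc b 1 then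
        if tsum b + 2 ≤ l then some (setx b.1 1 (xc b 1 + 2), b.2) else none
      else if xc b 1 + 1 = xbc b 1 then
        some (setx b.1 1 (xc b 1 + 1), setx b.2 1 (xbc b 1 - 1))
      else some (b.1, setx b.2 1 (xbc b 1 - 2))
    else none
  else if i = n then
    if 0 < xc b n then some (setx b.1 n (xc b n - 1), setx b.2 n (xbc b n + 1))
    else none
  else if i < n then
    if xbc b (i + 1) ≤ xc b (i + 1) then
      if 0 < xc b i then
        some (setx (setx b.1 i (xc b i - 1)) (i + 1) (xc b (i + 1) + 1), b.2)
      else none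
    else some (b.1, setx (setx b.2 (i + 1) (xbc b (i + 1) - 1)) i (xbc b i + 1))
  else none

def eCIter (n l i m : ℕ) (b : Tup n) : Option (Tup n) :=
  (fun o => Option.bind o (eC n l i))^[m] (some b)

def fCIter (n l i m : ℕ) (b : Tup n) : Option (Tup n) :=
  (fun o => Option.bind o (fC n l i))^[m] (some b)

/-- `ε_i(b) = max {m | ẽ_i^m b ≠ 0}` (C case). -/
noncomputable def epsC (n l i : ℕ) (b : Tup n) : ℕ :=
  sSup {m | eCIter n l i m b ≠ none}

/-- `φ_i(b) = max {m | f̃_i^m b ≠ 0}` (C case). -/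
noncomputable def phiC (n l i : ℕ) (b : Tup n) : ℕ :=
  sSup {m | fCIter n l i m b ≠ none}

/-- `ẽ_i` on the tensor product `B_l ⊗ B_k` (C case). -/
noncomputable def eTenC (n l k i : ℕ) (u : Tup n × Tup n) : Option (Tup n × Tup n) :=
  if epsC n k i u.2 ≤ phiC n l i u.1 then (eC n l i u.1).map (fun c => (c, u.2))
  else (eC n k i u.2).map (fun c => (u.1, c))

/-- `f̃_i` on the tensor product `B_l ⊗ B_k` (C case). -/
noncomputable def fTenC (n l k i : ℕ) (u : Tup n × Tup n) : Option (Tup n × Tup n) :=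
  if epsC n k i u.2 < phiC n l i u.1 then (fC n l i u.1).map (fun c => (c, u.2))
  else (fC n k i u.2).map (fun c => (u.1, c))

/-- `ι : B_l ⊗ B_k → B_k ⊗ B_l` is an isomorphism of `U_q'(C_n^{(1)})` crystals. -/
def IsIsoC (n l k : ℕ) (ι : Tup n × Tup n → Tup n × Tup n) : Prop :=
  Set.BijOn ι (BC n l ×ˢ BC n k) (BC n k ×ˢ BC n l) ∧
  ∀ u ∈ BC n l ×ˢ BC n k, ∀ i ≤ n,
    Option.map ι (eTenC n l k i u) = eTenC n k l i (ι u) ∧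
    Option.map ι (fTenC n l k i u) = fTenC n k l i (ι u)

/-- `H` is an energy function for the isomorphism `ι` (C case), normalized by
`H((l,0,…,0) ⊗ (0,k,---,0)) = 0`. -/
def IsEnergyC (n l k : ℕ) (ι : Tup n × Tup n → Tup n × Tup n)
    (H : Tup n × Tup n → ℤ) : Prop :=
  (∀ u ∈ BC n l ×ˢ BC n k, ∀ i ≤ n, ∀ v, eTenC n l k i u = some v →
      H v = H u +
        (if i = 0 then
          (if epsC n k 0 u.2 ≤ phiC n l 0 u.1 ∧ epsC n l 0 (ι u).2 ≤ phiC n k 0 (ι u).1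
           then 1
           else if phiC n l 0 u.1 < epsC n k 0 u.2 ∧ phiC n k 0 (ι u).1 < epsC n l 0 (ι u).2
           then -1 else 0)
         else 0)) ∧
  H (uvec n l, u2vec n k) = 0

/-! ### The `U_q'(A_{2n-1}^{(2)})` crystal `B_l` -/

def memA (n l : ℕ) (b : Tup n) : Prop := tsum b = l

def BA (n l : ℕ) : Set (Tup n) := {b | memA n l b}

/-- The operator `ẽ_i` (A case). -/
def eA (n i : ℕ) (b : Tup n) : Option (Tup n) :=
  if i = 0 then
    if 1 < n then
      if xbc b 2 < xc b 2 then some (setx b.1 2 (xc b 2 - 1), setx b.2 1 (xbc b 1 + 1))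
      else if 0 < xc b 1 then some (setx b.1 1 (xc b 1 - 1), setx b.2 2 (xbc b 2 + 1))
      else none
    else none
  else if i = n then
    if 0 < xbc b n then some (setx b.1 n (xc b n + 1), setx b.2 n (xbc b n - 1))
    else none
  else if i < n then
    if xbc b (i + 1) < xc b (i + 1) then
      some (setx (setx b.1 i (xc b i + 1)) (i + 1) (xc b (i + 1) - 1), b.2)
    else if 0 < xbc b i then
      some (b.1, setx (setx b.2 (i + 1) (xbc b (i + 1) + 1)) i (xbc b i - 1))
    else none
  else none

/-- The operator `f̃_i` (A case). -/
def fA (n i : ℕ) (b : Tup n) : Option (Tup n) :=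
  if i = 0 then
    if 1 < n then
      if xbc b 2 ≤ xc b 2 then
        if 0 < xbc b 1 then some (setx b.1 2 (xc b 2 + 1), setx b.2 1 (xbc b 1 - 1))
        else none
      else some (setx b.1 1 (xc b 1 + 1), setx b.2 2 (xbc b 2 - 1))
    else none
  else if i = n then
    if 0 < xc b n then some (setx b.1 n (xc b n - 1), setx b.2 n (xbc b n + 1))
    else none
  else if i < n then
    if xbc b (i + 1) ≤ xc b (i + 1) then
      if 0 < xc b i then
        some (setx (setx b.1 i (xc b i - 1)) (i + 1) (xc b (i + 1) + 1), b.2)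
      else none
    else some (b.1, setx (setx b.2 (i + 1) (xbc b (i + 1) - 1)) i (xbc b i + 1))
  else none

def eAIter (n i m : ℕ) (b : Tup n) : Option (Tup n) :=
  (fun o => Option.bind o (eA n i))^[m] (some b)

def fAIter (n i m : ℕ) (b : Tup n) : Option (Tup n) :=
  (fun o => Option.bind o (fA n i))^[m] (some b)

noncomputable def epsA (n i : ℕ) (b : Tup n) : ℕ :=
  sSup {m | eAIter n i m b ≠ none}

noncomputable def phiA (n i : ℕ) (b : Tup n) : ℕ :=
  sSup {m | fAIter n i m b ≠ none}

/-- `ẽ_i` on a tensor product (A case). -/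
noncomputable def eTenA (n i : ℕ) (u : Tup n × Tup n) : Option (Tup n × Tup n) :=
  if epsA n i u.2 ≤ phiA n i u.1 then (eA n i u.1).map (fun c => (c, u.2))
  else (eA n i u.2).map (fun c => (u.1, c))

/-- `f̃_i` on a tensor product (A case). -/
noncomputable def fTenA (n i : ℕ) (u : Tup n × Tup n) : Option (Tup n × Tup n) :=
  if epsA n i u.2 < phiA n i u.1 then (fA n i u.1).map (fun c => (c, u.2))
  else (fA n i u.2).map (fun c => (u.1, c))

/-- `ι : B_l ⊗ B_k → B_k ⊗ B_l` is an isomorphism of `U_q'(A_{2n-1}^{(2)})` crystals. -/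
def IsIsoA (n l k : ℕ) (ι : Tup n × Tup n → Tup n × Tup n) : Prop :=
  Set.BijOn ι (BA n l ×ˢ BA n k) (BA n k ×ˢ BA n l) ∧
  ∀ u ∈ BA n l ×ˢ BA n k, ∀ i ≤ n,
    Option.map ι (eTenA n i u) = eTenA n i (ι u) ∧
    Option.map ι (fTenA n i u) = fTenA n i (ι u)

/-- `H` is an energy function for `ι` (A case), normalized by
`H((l,0,…,0) ⊗ (0,0,---,k)) = 0`. -/
def IsEnergyA (n l k : ℕ) (ι : Tup n × Tup n → Tup n × Tup n)
    (H : Tup n × Tup n → ℤ) : Prop :=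
  (∀ u ∈ BA n l ×ˢ BA n k, ∀ i ≤ n, ∀ v, eTenA n i u = some v →
      H v = H u +
        (if i = 0 then
          (if epsA n 0 u.2 ≤ phiA n 0 u.1 ∧ epsA n 0 (ι u).2 ≤ phiA n 0 (ι u).1
           then 1
           else if phiA n 0 u.1 < epsA n 0 u.2 ∧ phiA n 0 (ι u).1 < epsA n 0 (ι u).2
           then -1 else 0)
         else 0)) ∧
  H (uvec n l, barvec n k) = 0

/-! ### Words, tableaux and column insertion

Letters are encoded as natural numbers: the unbarred letter `j` (for `0 ≤ j ≤ n`) is `j`,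
and the barred letter `j̄` is `2n+1-j`; the natural order of `ℕ` is the order
`0 < 1 < ⋯ < n < n̄ < ⋯ < 1̄ < 0̄`.  A (two-row) tableau is encoded as the list of its
columns (left to right), each column being the list of its entries (top to bottom). -/

/-- The barred partner `j̄` of an unbarred letter `j`. -/
def bar (n j : ℕ) : ℕ := 2 * n + 1 - j

/-- Column insertion of a letter into a tableau with at most two rows. -/
def insertLetter (n : ℕ) : ℕ → List (List ℕ) → List (List ℕ)
  | a, [] => [[a]]
  | a, [p] :: rest =>
      if a ≤ p then [a] :: insertLetter n p rest else [p, a] :: rest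
  | a, [p, q] :: rest =>
      if p ≠ 0 ∧ p ≤ n ∧ q = bar n p ∧ p ≤ a ∧ a ≤ q then
        -- the column is a pair `(x, x̄)` with `x ≠ 0` and `x ≤ a ≤ x̄`
        [p - 1, a] :: insertLetter n (bar n (p - 1)) rest
      else if n + 1 ≤ q ∧ bar n q < p ∧ p < q ∧ a = bar n q ∧ q ≠ n + 1 then
        -- the column is `(β, x̄)` with `x < β < x̄`, `a = x` and `x ≠ n`
        [a + 1, bar n (a + 1)] :: insertLetter n p rest
      else if a ≤ p then [a, q] :: insertLetter n p rest
      else if a ≤ q then [p, a] :: insertLetter n q rest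
      else [p, q, a] :: rest
  | a, C :: rest => (C ++ [a]) :: rest

/-- Column insertion of a word `u = u_1 ⋯ u_j` into a tableau: `u_j` first, `u_1` last. -/
def insertWord (n : ℕ) (u : List ℕ) (T : List (List ℕ)) : List (List ℕ) :=
  u.foldr (fun a T => insertLetter n a T) T

/-- One step of reverse insertion: letter `g` comes back (moving leftward) into a column;
returns the restored column together with the letter passed further left. -/
def revStep (n g : ℕ) (C : List ℕ) : List ℕ × ℕ :=
  match C with
  | [p] => ([g], p)
  | [p, q] =>
      if p ≠ 0 ∧ p ≤ n ∧ q = bar n p ∧ p ≤ g ∧ g ≤ q then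
        ([g, bar n (p - 1)], p - 1)
      else if p ≤ n ∧ g = bar n p ∧ p < q ∧ q < g ∧ p ≠ n then
        ([p + 1, bar n (p + 1)], q)
      else if q ≤ g then ([p, g], q)
      else ([g, q], p)
  | _ => (C, g)

/-- Reverse insertion of a letter through a list of columns, from right to left;
returns the new columns and the letter ejected from the leftmost column. -/
def revPass (n g : ℕ) : List (List ℕ) → List (List ℕ) × ℕ
  | [] => ([], g)
  | C :: rest =>
      let p := revPass n g rest
      let q := revStep n p.2 C
      (q.1 :: p.1, q.2)

/-- Reverse-bump the rightmost cell of the first row (the last column, a single box). -/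
def rbFirst (n : ℕ) (T : List (List ℕ)) : List (List ℕ) × ℕ :=
  match T.getLast? with
  | some [a] => revPass n a T.dropLast
  | _ => (T, 0)

/-- Number of columns of height (at least) two, i.e. the length of the second row. -/
def numTwoCols (T : List (List ℕ)) : ℕ :=
  (T.filter (fun C => decide (2 ≤ C.length))).length

/-- Reverse-bump the rightmost cell of the second row. -/
def rbSecond (n : ℕ) (T : List (List ℕ)) : List (List ℕ) × ℕ :=
  match (T.drop (numTwoCols T - 1)).head? with
  | some [a, b] =>
      let p := revPass n b (T.take (numTwoCols T - 1))
      (p.1 ++ [a] :: T.drop (numTwoCols T), p.2)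
  | _ => (T, 0)

/-- Iterate a reverse-bumping step, collecting the ejected letters in order of ejection. -/
def rbIter (step : List (List ℕ) → List (List ℕ) × ℕ) :
    ℕ → List (List ℕ) → List (List ℕ) × List ℕ
  | 0, T => (T, [])
  | c + 1, T =>
      let p := step T
      let q := rbIter step c p.1
      (q.1, p.2 :: q.2)

/-- A one-row word regarded as a tableau (list of one-box columns). -/
def rowCols (w : List ℕ) : List (List ℕ) := w.map (fun a => [a])

/-- The row word of a one-row tableau. -/
def colsWord (T : List (List ℕ)) : List ℕ := T.foldr (fun C acc => C ++ acc) []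

/-- The word `1^{x_1} ⋯ n^{x_n} n̄^{x̄_n} ⋯ 1̄^{x̄_1}`. -/
def coreWord (n : ℕ) (b : Tup n) : List ℕ :=
  ((List.finRange n).map (fun i => List.replicate (b.1 i) ((i : ℕ) + 1))).foldr (· ++ ·) []
  ++ ((List.finRange n).reverse.map
      (fun i => List.replicate (b.2 i) (bar n ((i : ℕ) + 1)))).foldr (· ++ ·) []

/-- The word `𝕋(b) = 0^{x_0} 1^{x_1} ⋯ 1̄^{x̄_1} 0̄^{x_0}` of an element of the
`C_n^{(1)}` crystal `B_l`. -/
def rowWordC (n l : ℕ) (b : Tup n) : List ℕ :=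
  List.replicate (x0 l b) 0 ++ coreWord n b ++ List.replicate (x0 l b) (bar n 0)

/-- The word `𝕋(b)` with `z` pairs `(0, 0̄)` removed. -/
def hatWordC (n l z : ℕ) (b : Tup n) : List ℕ :=
  List.replicate (x0 l b - z) 0 ++ coreWord n b ++ List.replicate (x0 l b - z) (bar n 0)

/-- The word `𝒯(b) = 1^{x_1} ⋯ 1̄^{x̄_1}` of an element of the `A_{2n-1}^{(2)}` crystal. -/
def rowWordA (n : ℕ) (b : Tup n) : List ℕ := coreWord n b


theorem iter_none' {α : Type*} (f : α → Option α) (m : ℕ) :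
    (fun o => Option.bind o f)^[m] none = none := by
  induction m with
  | zero => rfl
  | succ m ih => rw [Function.iterate_succ_apply]; exact ih

theorem iter_char {α : Type*} (f : α → Option α) (P : α → Prop) (N : α → ℕ)
    (h0 : ∀ b, P b → f b = none → N b = 0)
    (h1 : ∀ b c, P b → f b = some c → P c ∧ N c + 1 = N b) (m : ℕ) :
    ∀ b, P b → ((fun o => Option.bind o f)^[m] (some b) ≠ none ↔ m ≤ N b) := by
  induction m with
  | zero => intro b _; simp
  | succ m ih =>
    intro b hb
    rw [Function.iterate_succ_apply]
    rcases hfb : f b with _ | c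
    · have := h0 b hb hfb
      simp [hfb, iter_none', this]
    · obtain ⟨hc, hN⟩ := h1 b c hb hfb
      simp only [Option.bind_some, hfb]
      rw [ih c hc]; omega

theorem sSup_char {N : ℕ} {p : ℕ → Prop} (h : ∀ m, p m ↔ m ≤ N) : sSup {m | p m} = N := by
  have : {m | p m} = Set.Iic N := by ext m; simp [h]
  rw [this]; exact csSup_Iic

def N1 (l : ℕ) {n : ℕ} (b : Tup n) : ℕ := (l - tsum b) / 2 + (xc b 1 - xbc b 1)
def N2 (l : ℕ) {n : ℕ} (b : Tup n) : ℕ := (l - tsum b) / 2 + (xbc b 1 - xc b 1)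

theorem xc_mk {n : ℕ} (hn : 0 < n) (f g : Fin n → ℕ) : xc (f, g) 1 = f ⟨0, hn⟩ := by
  simp [xc, hn]
theorem xbc_mk {n : ℕ} (hn : 0 < n) (f g : Fin n → ℕ) : xbc (f, g) 1 = g ⟨0, hn⟩ := by
  simp [xbc, hn]
theorem setx_zero {n : ℕ} (hn : 0 < n) (f : Fin n → ℕ) (v : ℕ) : setx f 1 v ⟨0, hn⟩ = v := by
  simp [setx]
theorem sum_setx {n : ℕ} (hn : 0 < n) (f : Fin n → ℕ) (v : ℕ) :
    (∑ i, setx f 1 v i) + f ⟨0, hn⟩ = (∑ i, f i) + v := by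
  obtain ⟨m, rfl⟩ : ∃ m, n = m + 1 := ⟨n - 1, by omega⟩
  rw [Fin.sum_univ_succ, Fin.sum_univ_succ]
  simp [setx]
  omega
theorem le_sum' {n : ℕ} (hn : 0 < n) (f : Fin n → ℕ) : f ⟨0, hn⟩ ≤ ∑ i, f i :=
  Finset.single_le_sum (f := f) (fun _ _ => Nat.zero_le _) (Finset.mem_univ _)
theorem tsum_mk {n : ℕ} (f g : Fin n → ℕ) : tsum (f, g) = (∑ i, f i) + ∑ i, g i := by
  simp [tsum, Finset.sum_add_distrib]

theorem eC_step {n l : ℕ} (hn : 0 < n) (b : Tup n) (hb : tsum b ≤ l) :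
    (eC n l 0 b = none → N1 l b = 0) ∧
    (∀ c, eC n l 0 b = some c →
      tsum c ≤ l ∧ N1 l c + 1 = N1 l b ∧ N2 l c = N2 l b + 1) := by
  obtain ⟨f, g⟩ := b
  have sf := fun v => sum_setx hn f v
  have sg := fun v => sum_setx hn g v
  have lf := le_sum' hn f
  have lg := le_sum' hn g
  simp only [eC, N1, N2, hn, if_true, tsum_mk, xc_mk hn, xbc_mk hn] at hb ⊢
  generalize ha : f ⟨0, hn⟩ = a at *
  generalize hd : g ⟨0, hn⟩ = d at *
  constructor
  · split_ifs <;> intro h <;> first | omega | simp at h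
  · intro c
    split_ifs <;> intro h <;> simp only [Option.some.injEq, reduceCtorEq] at h <;> subst h <;>
      simp only [tsum_mk, xc_mk hn, xbc_mk hn, setx_zero hn, ha, hd]
    · have := sf (a - 2); omega
    · have := sf (a - 1); have := sg (d + 1); omega
    · have := sg (d + 2); omega

theorem fC_step {n l : ℕ} (hn : 0 < n) (b : Tup n) (hb : tsum b ≤ l) :
    (fC n l 0 b = none → N2 l b = 0) ∧
    (∀ c, fC n l 0 b = some c → tsum c ≤ l ∧ N2 l c + 1 = N2 l b) := by
  obtain ⟨f, g⟩ := b
  have sf := fun v => sum_setx hn f v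
  have sg := fun v => sum_setx hn g v
  have lf := le_sum' hn f
  have lg := le_sum' hn g
  simp only [fC, N2, hn, if_true, tsum_mk, xc_mk hn, xbc_mk hn] at hb ⊢
  generalize ha : f ⟨0, hn⟩ = a at *
  generalize hd : g ⟨0, hn⟩ = d at *
  constructor
  · split_ifs <;> intro h <;> first | omega | simp at h
  · intro c
    split_ifs <;> intro h <;> simp only [Option.some.injEq, reduceCtorEq] at h <;> subst h <;>
      simp only [tsum_mk, xc_mk hn, xbc_mk hn, setx_zero hn, ha, hd]
    · have := sf (a + 2); omega
    · have := sf (a + 1); have := sg (d - 1); omega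
    · have := sg (d - 2); omega

theorem epsC_eq {n l : ℕ} (hn : 0 < n) (b : Tup n) (hb : tsum b ≤ l) :
    epsC n l 0 b = N1 l b :=
  sSup_char fun m => iter_char (eC n l 0) (fun b => tsum b ≤ l) (N1 l)
    (fun b hb => (eC_step hn b hb).1)
    (fun b c hb h => ⟨((eC_step hn b hb).2 c h).1, ((eC_step hn b hb).2 c h).2.1⟩) m b hb

theorem phiC_eq {n l : ℕ} (hn : 0 < n) (b : Tup n) (hb : tsum b ≤ l) :
    phiC n l 0 b = N2 l b :=
  sSup_char fun m => iter_char (fC n l 0) (fun b => tsum b ≤ l) (N2 l)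
    (fun b hb => (fC_step hn b hb).1) (fun b c hb h => (fC_step hn b hb).2 c h) m b hb

theorem N1_max {n l : ℕ} (hn : 0 < n) (hl : 1 ≤ l) (b : Tup n) (hb : tsum b ≤ l) :
    N1 l b ≤ l ∧ (l ≤ N1 l b → b = uvec n l) := by
  obtain ⟨f, g⟩ := b
  obtain ⟨m, rfl⟩ : ∃ m, n = m + 1 := ⟨n - 1, by omega⟩
  simp only [N1, tsum_mk, xc_mk hn, xbc_mk hn] at hb ⊢
  rw [Fin.sum_univ_succ, Fin.sum_univ_succ] at *
  change f 0 + _ + (g 0 + _) ≤ l at hb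
  change (l - (f 0 + _ + (g 0 + _))) / 2 + (f 0 - g 0) ≤ l ∧
    (l ≤ (l - (f 0 + _ + (g 0 + _))) / 2 + (f 0 - g 0) → _)
  refine ⟨by omega, fun h => ?_⟩
  have h1 : ∑ i : Fin m, f i.succ = 0 := by omega
  have h2 : ∑ i : Fin m, g i.succ = 0 := by omega
  have h3 : f 0 = l := by omega
  have h4 : g 0 = 0 := by omega
  simp only [Finset.sum_eq_zero_iff, Finset.mem_univ, true_implies] at h1 h2
  refine Prod.ext ?_ ?_ <;> funext j <;> refine Fin.cases ?_ (fun i => ?_) j <;>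
    simp [uvec, h1, h2, h3, h4]

theorem N_uvec {n l : ℕ} (hn : 0 < n) : N1 l (uvec n l) = l ∧ N2 l (uvec n l) = 0 := by
  obtain ⟨m, rfl⟩ : ∃ m, n = m + 1 := ⟨n - 1, by omega⟩
  simp [N1, N2, uvec, tsum_mk, xc, xbc, Fin.sum_univ_succ]

theorem ten_char {n l k : ℕ} (hn : 0 < n) (m : ℕ) (u : Tup n × Tup n)
    (hu : tsum u.1 ≤ l ∧ tsum u.2 ≤ k) :
    (fun o => Option.bind o (eTenC n l k 0))^[m] (some u) ≠ none ↔
      m ≤ N1 l u.1 + (N1 k u.2 - N2 l u.1) := by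
  refine iter_char (eTenC n l k 0) (fun u => tsum u.1 ≤ l ∧ tsum u.2 ≤ k)
    (fun u => N1 l u.1 + (N1 k u.2 - N2 l u.1)) ?_ ?_ m u hu
  · rintro ⟨b, c⟩ ⟨hb, hc⟩ h
    simp only [eTenC, epsC_eq hn c hc, phiC_eq hn b hb] at *
    split_ifs at h
    · have := (eC_step hn b hb).1 (by simpa using h); omega
    · have := (eC_step hn c hc).1 (by simpa using h); omega
  · rintro ⟨b, c⟩ v ⟨hb, hc⟩ h
    simp only [eTenC, epsC_eq hn c hc, phiC_eq hn b hb] at *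
    split_ifs at h
    · obtain ⟨b', h', rfl⟩ := Option.map_eq_some_iff.1 h
      have := (eC_step hn b hb).2 b' h'
      dsimp only; omega
    · obtain ⟨b', h', rfl⟩ := Option.map_eq_some_iff.1 h
      have := (eC_step hn c hc).2 b' h'
      dsimp only; omega

/-- In the `U_q'(C_n^{(1)})` crystal `B_l ⊗ B_k`, an element `u` satisfies
`ẽ_0^{l+k}(u) ≠ 0` if and only if `u = (l,0,…,0) ⊗ (k,0,…,0)`. -/
theorem unique_e0_survivor_C
    (n l k : ℕ) (hn : 2 ≤ n) (hl : 1 ≤ l) (hk : 1 ≤ k) :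
    ∀ u ∈ BC n l ×ˢ BC n k,
      ((fun o => Option.bind o (eTenC n l k 0))^[l + k] (some u) ≠ none ↔
        u = (uvec n l, uvec n k)) := by
  intro u hu
  have h0 : 0 < n := by omega
  obtain ⟨hb, hc⟩ : tsum u.1 ≤ l ∧ tsum u.2 ≤ k := ⟨hu.1.1, hu.2.1⟩
  rw [ten_char h0 _ u ⟨hb, hc⟩]
  have m1 := N1_max h0 hl u.1 hb
  have m2 := N1_max h0 hk u.2 hc
  constructor
  · intro h
    exact Prod.ext (m1.2 (by omega)) (m2.2 (by omega))
  · rintro rfl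
    have e1 := N_uvec (l := l) h0
    have e2 := N_uvec (l := k) h0
    dsimp only; omega
end KTT
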